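/- arXiv:1812.10640 — 2 statements merged into one kernel-verified Lean document; each statement's English description precedes it below -/
import Mathlib

section
/- Let λ = (h, 1^{ℓ−1}) be a hook partition and let k = (k_{ij}) be a filling of D(λ) by positive integers with k_{1h} > 1 and k_{ℓ1} > 1. Then the Schur multiple zeta value ζ_λ(k) = Σ_{0 < m_{11} ≤ m_{12} ≤ ⋯ ≤ m_{1h}, 0 < m_{11} < m_{21} < ⋯ < m_{ℓ1}} 1/(m_{11}^{k_{11}} ⋯ m_{1h}^{k_{1h}} m_{21}^{k_{21}} ⋯ m_{ℓ1}^{k_{ℓ1}}) has the iterated integral representation ζ_λ(k) = (1/(Γ(k_{11}) ⋯ Γ(k_{1h}) Γ(k_{21}) ⋯ Γ(k_{ℓ1}))) ∫_0^∞ ⋯ ∫_0^∞ x_{11}^{k_{11}−1} ⋯ x_{ℓ1}^{k_{ℓ1}−1} x_{12}^{k_{12}−1} ⋯ x_{1h}^{k_{1h}−1} · [1/(e^{x_{11}+⋯+x_{ℓ1}+x_{12}+⋯+x_{1h}} − 1)] · [1/(e^{x_{21}+⋯+x_{ℓ1}} − 1)] ⋯ [1/(e^{x_{ℓ1}} − 1)]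 · [e^{x_{12}+⋯+x_{1h}}/(e^{x_{12}+⋯+x_{1h}} − 1)] ⋯ [e^{x_{1h}}/(e^{x_{1h}} − 1)] dx_{11} ⋯ dx_{ℓ1} dx_{12} ⋯ dx_{1h}. -/
open MeasureTheory

open scoped ENNReal in
theorem aux_lintegral_prod : ∀ (n : ℕ) (μ : Measure ℝ) [SigmaFinite μ] (f : Fin n → ℝ → ℝ≥0∞)
    (_ : ∀ i, Measurable (f i)),
    ∫⁻ x : Fin n → ℝ, ∏ i, f i (x i) ∂(Measure.pi fun _ => μ) = ∏ i, ∫⁻ t, f i t ∂μ := by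
  intro n
  induction n with
  | zero => intro μ _ f hf; simp
  | succ n ih =>
    intro μ _ f hf
    have hm := (measurePreserving_piFinSuccAbove (fun _ : Fin (n + 1) => μ) 0).symm
    rw [← hm.lintegral_comp_emb (MeasurableEquiv.measurableEmbedding _)]
    simp only [Fin.prod_univ_succ, MeasurableEquiv.piFinSuccAbove_symm_apply, Fin.insertNthEquiv,
      Fin.insertNth_zero, Equiv.coe_fn_mk, Fin.cons_zero, Fin.cons_succ, Fin.zero_succAbove,
      cast_eq]
    rw [lintegral_prod_mul (f := f 0) (g := fun y : Fin n → ℝ => ∏ i, f i.succ (y i))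
      (hf 0).aemeasurable
      (Finset.measurable_fun_prod _ fun i _ =>
        (hf i.succ).comp (measurable_pi_apply i)).aemeasurable,
      ih μ (fun i => f i.succ) fun i => hf i.succ]

/-- The exponential weight. -/
noncomputable def auxE (n : ℕ) (s : ℝ) : ENNReal := ENNReal.ofReal (Real.exp (-(n * s)))

theorem auxE_add (n : ℕ) (s t : ℝ) : auxE n (s + t) = auxE n s * auxE n t := by
  unfold auxE
  rw [← ENNReal.ofReal_mul (Real.exp_pos _).le, ← Real.exp_add]
  congr 2
  ring

theorem aux_geom0 (s : ℝ) (hs : 0 < s) :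
    ∑' n : ℕ, auxE n s = ENNReal.ofReal (Real.exp s / (Real.exp s - 1)) := by
  have h1 : Real.exp (-s) < 1 := by simpa using hs
  have hE : ∀ n : ℕ, Real.exp (-(n * s)) = Real.exp (-s) ^ n := by
    intro n; rw [← Real.exp_nat_mul]; congr 1; ring
  have hsum := hasSum_geometric_of_lt_one (Real.exp_pos (-s)).le h1
  unfold auxE
  simp only [hE]
  rw [← ENNReal.ofReal_tsum_of_nonneg (fun n => by positivity) hsum.summable, hsum.tsum_eq]
  congr 1
  have h2 : Real.exp s - 1 ≠ 0 := by
    have : 1 < Real.exp s := by simpa using hs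
    linarith
  rw [Real.exp_neg]
  have h3 := (Real.exp_pos s).ne'
  have h4 : 1 - (Real.exp s)⁻¹ = (Real.exp s - 1) / Real.exp s := by field_simp
  rw [h4, inv_div]

theorem aux_geom_le (m : ℕ) (s : ℝ) (hs : 0 < s) :
    ∑' n : ℕ, (if m ≤ n then auxE n s else 0) =
      auxE m s * ENNReal.ofReal (Real.exp s / (Real.exp s - 1)) := by
  rw [← aux_geom0 s hs, ← ENNReal.tsum_mul_left]
  have hinj : Function.Injective (fun n : ℕ => m + n) := add_right_injective m
  rw [← hinj.tsum_eq]
  · refine tsum_congr fun n => ?_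
    simp only [le_add_iff_nonneg_right, zero_le, if_true]
    unfold auxE
    rw [← ENNReal.ofReal_mul (Real.exp_pos _).le, ← Real.exp_add]
    congr 2
    push_cast
    ring
  · intro n hn
    have : m ≤ n := by
      by_contra h
      simp [h] at hn
    exact ⟨n - m, by simp; omega⟩

theorem aux_geom_lt (m : ℕ) (s : ℝ) (hs : 0 < s) :
    ∑' n : ℕ, (if m < n then auxE n s else 0) =
      auxE m s * ENNReal.ofReal ((Real.exp s - 1)⁻¹) := by
  have := aux_geom_le (m + 1) s hs
  simp only [Nat.succ_le_iff] at this
  rw [this]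
  unfold auxE
  rw [← ENNReal.ofReal_mul (Real.exp_pos _).le, ← ENNReal.ofReal_mul (Real.exp_pos _).le]
  congr 1
  rw [div_eq_mul_inv, ← mul_assoc, ← Real.exp_add]
  congr 2
  push_cast
  ring

theorem aux_chain (r : ℕ → ℕ → Prop) [DecidableRel r] (P : ∀ n : ℕ, (Fin (n + 1) → ℕ) → Prop)
    [∀ n f, Decidable (P n f)] (C : ℝ → ENNReal)
    (hC : ∀ (m : ℕ) (s : ℝ), 0 < s →
      ∑' n : ℕ, (if r m n then auxE n s else 0) = auxE m s * C s)
    (h0 : ∀ f, P 0 f)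
    (hs : ∀ n (a b : ℕ) (g : Fin n → ℕ), P (n + 1) (Fin.cons a (Fin.cons b g : Fin (n + 1) → ℕ)) ↔
      r a b ∧ P n (Fin.cons b g)) :
    ∀ (q : ℕ) (y : Fin q → ℝ) (_ : ∀ i, 0 < y i) (m : ℕ),
    ∑' f : Fin q → ℕ, (if P q (Fin.cons m f) then ∏ i, auxE (f i) (y i) else 0) =
      auxE m (∑ i, y i) * ∏ i, C (∑ i' ∈ Finset.Ici i, y i') := by
  intro q
  induction q with
  | zero => intro y hy m; simp [h0, auxE]
  | succ q ih =>
    intro y hy m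
    rw [← (Fin.consEquiv (fun _ : Fin (q + 1) => ℕ)).tsum_eq, ENNReal.tsum_prod']
    have hpos : 0 < ∑ i, y i := Finset.sum_pos (fun i _ => hy i) Finset.univ_nonempty
    have hI : ∑ i' ∈ Finset.Ici (0 : Fin (q + 1)), y i' = ∑ i, y i := by
      congr 1
      ext i
      simp
    rw [Fin.prod_univ_succ, hI, ← mul_assoc, ← hC m _ hpos, ← ENNReal.tsum_mul_right]
    refine tsum_congr fun c => ?_
    simp only [Fin.consEquiv, Equiv.coe_fn_mk, hs]
    by_cases hr : r m c
    · simp only [hr, true_and, if_true, Fin.prod_univ_succ, Fin.cons_zero, Fin.cons_succ]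
      have := ih (fun i => y i.succ) (fun i => hy _) c
      rw [Fin.sum_univ_succ, auxE_add, mul_assoc]
      simp only [Fin.sum_Ici_succ]
      rw [← this, ← ENNReal.tsum_mul_left]
      refine tsum_congr fun g => ?_
      split_ifs <;> simp
    · simp [hr]

theorem aux_cons {n : ℕ} (r : ℕ → ℕ → Prop) [IsTrans ℕ r] (a b : ℕ) (g : Fin n → ℕ) :
    Relator.LiftFun (· < ·) r (Fin.cons a (Fin.cons b g : Fin (n + 1) → ℕ) : Fin (n + 2) → ℕ)
      (Fin.cons a (Fin.cons b g : Fin (n + 1) → ℕ) : Fin (n + 2) → ℕ) ↔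
    r a b ∧ Relator.LiftFun (· < ·) r (Fin.cons b g : Fin (n + 1) → ℕ)
      (Fin.cons b g : Fin (n + 1) → ℕ) :=
  liftFun_vecCons r (f := Fin.cons b g) (a := a)

open Classical in
theorem aux_point (p q : ℕ) (x : Fin (p + 1) → ℝ) (y : Fin (q + 1) → ℝ)
    (hx : ∀ i, 0 < x i) (hy : ∀ i, 0 < y i) :
    (∑' M : {M : (Fin (p + 1) → ℕ) × (Fin (q + 1) → ℕ) //
        Monotone M.1 ∧ 1 ≤ M.1 0 ∧ StrictMono M.2 ∧ M.1 0 < M.2 0},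
      (∏ j, auxE (M.1.1 j) (x j)) * ∏ i, auxE (M.1.2 i) (y i)) =
    ENNReal.ofReal ((Real.exp ((∑ j, x j) + ∑ i, y i) - 1)⁻¹) *
         (∏ i : Fin (q + 1), ENNReal.ofReal ((Real.exp (∑ i' ∈ Finset.Ici i, y i') - 1)⁻¹)) *
         ∏ j : Fin p, ENNReal.ofReal (Real.exp (∑ j' ∈ Finset.Ici j.succ, x j') /
            (Real.exp (∑ j' ∈ Finset.Ici j.succ, x j') - 1)) := by
  have hle := aux_chain (· ≤ ·) (fun n f => Monotone f) _ aux_geom_le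
    (fun f => Subsingleton.monotone (α := Fin 1) f) (fun n a b g => by
      simp only [monotone_iff_forall_lt]; exact aux_cons (· ≤ ·) a b g)
    p (fun j => x j.succ) (fun _ => hx _)
  have hlt := aux_chain (· < ·) (fun n f => StrictMono f) _ aux_geom_lt
    (fun f => Subsingleton.strictMono (α := Fin 1) f) (fun n a b g => aux_cons (· < ·) a b g)
    (q + 1) y hy
  have hT : 0 < (∑ j, x j) + ∑ i, y i :=
    add_pos (Finset.sum_pos (fun i _ => hx i) Finset.univ_nonempty)
      (Finset.sum_pos (fun i _ => hy i) Finset.univ_nonempty)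
  have h0 := aux_geom_lt 0 _ hT
  have e0 : ∀ s, auxE 0 s = 1 := by intro s; simp [auxE]
  rw [e0, one_mul] at h0
  rw [← h0]
  have hsub := tsum_subtype {M : (Fin (p + 1) → ℕ) × (Fin (q + 1) → ℕ) |
        Monotone M.1 ∧ 1 ≤ M.1 0 ∧ StrictMono M.2 ∧ M.1 0 < M.2 0}
        (fun M => (∏ j, auxE (M.1 j) (x j)) * ∏ i, auxE (M.2 i) (y i))
  refine hsub.trans ?_
  rw [ENNReal.tsum_prod', ← (Fin.consEquiv (fun _ : Fin (p + 1) => ℕ)).tsum_eq, ENNReal.tsum_prod',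
    ← ENNReal.tsum_mul_right, ← ENNReal.tsum_mul_right]
  refine tsum_congr fun m => ?_
  have hcond : ∀ n : Fin (q + 1) → ℕ,
      StrictMono (Fin.cons m n : Fin (q + 2) → ℕ) ↔ m < n 0 ∧ StrictMono n := fun n =>
    strictMono_vecCons (f := n) (a := m)
  have key : ∀ (a : Fin p → ℕ) (n : Fin (q + 1) → ℕ),
      Set.indicator {M : (Fin (p + 1) → ℕ) × (Fin (q + 1) → ℕ) |
        Monotone M.1 ∧ 1 ≤ M.1 0 ∧ StrictMono M.2 ∧ M.1 0 < M.2 0}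
        (fun M => (∏ j, auxE (M.1 j) (x j)) * ∏ i, auxE (M.2 i) (y i))
        ((Fin.consEquiv (fun _ : Fin (p + 1) => ℕ)) (m, a), n) =
      (if 0 < m then auxE m (x 0) else 0) *
        (if Monotone (Fin.cons m a : Fin (p + 1) → ℕ) then ∏ j, auxE (a j) (x j.succ) else 0) *
        (if StrictMono (Fin.cons m n : Fin (q + 2) → ℕ) then ∏ i, auxE (n i) (y i) else 0) := by
    intro a n
    simp only [hcond]
    simp only [Set.indicator, Set.mem_setOf_eq, Fin.consEquiv, Equiv.coe_fn_mk, Fin.cons_zero,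
      Fin.prod_univ_succ (n := p), Fin.cons_succ]
    by_cases h1 : 0 < m <;> by_cases h2 : Monotone (Fin.cons m a : Fin (p + 1) → ℕ) <;>
      by_cases h3 : m < n 0 <;> by_cases h4 : StrictMono n <;>
      simp [h1, h2, h3, h4, Nat.succ_le_iff]
  simp only [key, ENNReal.tsum_mul_left, ENNReal.tsum_mul_right]
  rw [hle m, hlt m]
  split_ifs
  · rw [auxE_add, Fin.sum_univ_succ x, auxE_add]
    simp only [Fin.sum_Ici_succ]
    ring
  · simp

theorem aux_gamma (k m : ℕ) (hk : 1 ≤ k) (hm : 1 ≤ m) :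
    ∫⁻ t in Set.Ioi (0 : ℝ), ENNReal.ofReal (t ^ (k - 1)) * auxE m t =
      ENNReal.ofReal (Real.Gamma k * ((m : ℝ) ^ k)⁻¹) := by
  have hm' : (0 : ℝ) < m := by exact_mod_cast hm
  have hk' : (0 : ℝ) < k := by exact_mod_cast hk
  have h := Real.integral_rpow_mul_exp_neg_mul_Ioi hk' hm'
  have hG := Real.Gamma_pos_of_pos hk'
  have hne : (1 / (m : ℝ)) ^ (k : ℝ) * Real.Gamma k ≠ 0 := by positivity
  have hint := not_imp_comm.1 integral_undef (h.trans_ne hne)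
  have h2 := ofReal_integral_eq_lintegral_ofReal hint
    ((ae_restrict_iff' measurableSet_Ioi).2 (Filter.Eventually.of_forall fun t ht => by
      have : (0 : ℝ) < t := ht
      simp only [Pi.zero_apply]
      positivity))
  rw [h] at h2
  have h3 : Real.Gamma k * ((m : ℝ) ^ k)⁻¹ = (1 / (m : ℝ)) ^ (k : ℝ) * Real.Gamma k := by
    rw [Real.rpow_natCast, one_div, inv_pow, mul_comm]
  rw [h3, h2]
  refine setLIntegral_congr_fun measurableSet_Ioi fun t ht => ?_
  have ht' : (0 : ℝ) < t := ht
  simp only [auxE]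
  rw [← ENNReal.ofReal_mul (by positivity), ← Real.rpow_natCast, Nat.cast_sub hk, Nat.cast_one]

theorem aux_meas (k m : ℕ) :
    Measurable fun t : ℝ => ENNReal.ofReal (t ^ (k - 1)) * auxE m t := by
  unfold auxE
  fun_prop

/-- For the hook partition `λ = (h, 1^{ℓ-1})` with `h = p + 1` and
`ℓ = q + 2`, a filling `k` of `D(λ)` by positive integers (row `kr = (k_{11},…,k_{1h})`,
column below the first box `kc = (k_{21},…,k_{ℓ1})`) with `k_{1h} > 1` and `k_{ℓ1} > 1`,
the Schur multiple zeta value `ζ_λ(k)` (sum over semistandard Young tableaux of hook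
shape, i.e. pairs `(row, col)` with the row weakly increasing, the column strictly
increasing and starting strictly above the `(1,1)` entry) equals the iterated integral
of the statement, over the positive orthant in the variables
`x_{11},…,x_{1h}` (first component) and `x_{21},…,x_{ℓ1}` (second component). -/
theorem stmt1 (p q : ℕ) (kr : Fin (p + 1) → ℕ) (kc : Fin (q + 1) → ℕ)
    (hkr : ∀ j, 1 ≤ kr j) (hkc : ∀ i, 1 ≤ kc i)
    (hch : 1 < kr (Fin.last p)) (hcl : 1 < kc (Fin.last q)) :
    (∑' M : {M : (Fin (p + 1) → ℕ) × (Fin (q + 1) → ℕ) //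
        Monotone M.1 ∧ 1 ≤ M.1 0 ∧ StrictMono M.2 ∧ M.1 0 < M.2 0},
      ((∏ j, (M.1.1 j : ℝ) ^ kr j) * ∏ i, (M.1.2 i : ℝ) ^ kc i)⁻¹) =
    ((∏ j, Real.Gamma (kr j : ℝ)) * ∏ i, Real.Gamma (kc i : ℝ))⁻¹ *
      ∫ x in (Set.univ.pi fun _ : Fin (p + 1) => Set.Ioi (0 : ℝ)) ×ˢ
          (Set.univ.pi fun _ : Fin (q + 1) => Set.Ioi (0 : ℝ)),
        ((∏ j, x.1 j ^ (kr j - 1)) * ∏ i, x.2 i ^ (kc i - 1)) *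
        ((Real.exp ((∑ j, x.1 j) + ∑ i, x.2 i) - 1)⁻¹ *
         (∏ i : Fin (q + 1), (Real.exp (∑ i' ∈ Finset.Ici i, x.2 i') - 1)⁻¹) *
         ∏ j : Fin p, Real.exp (∑ j' ∈ Finset.Ici j.succ, x.1 j') /
            (Real.exp (∑ j' ∈ Finset.Ici j.succ, x.1 j') - 1)) := by
  set D : Set ((Fin (p + 1) → ℝ) × (Fin (q + 1) → ℝ)) :=
    (Set.univ.pi fun _ : Fin (p + 1) => Set.Ioi (0 : ℝ)) ×ˢ
          (Set.univ.pi fun _ : Fin (q + 1) => Set.Ioi (0 : ℝ)) with hD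
  have hDm : MeasurableSet D :=
    (MeasurableSet.univ_pi fun _ => measurableSet_Ioi).prod
      (MeasurableSet.univ_pi fun _ => measurableSet_Ioi)
  have hexp : ∀ s : ℝ, 0 < s → 0 < Real.exp s - 1 := fun s hs => by
    have : 1 < Real.exp s := by simpa using hs
    linarith
  have hDpos : ∀ x ∈ D, (∀ j, 0 < x.1 j) ∧ (∀ i, 0 < x.2 i) := by
    intro x hx
    simpa [hD, Set.mem_prod, Set.mem_univ_pi] using hx
  -- positivity of the three exponential factors
  have hA : ∀ x ∈ D, 0 < Real.exp ((∑ j, x.1 j) + ∑ i, x.2 i) - 1 := fun x hx =>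
    hexp _ (add_pos (Finset.sum_pos (fun i _ => (hDpos x hx).1 i) Finset.univ_nonempty)
      (Finset.sum_pos (fun i _ => (hDpos x hx).2 i) Finset.univ_nonempty))
  have hB : ∀ x ∈ D, ∀ i, 0 < Real.exp (∑ i' ∈ Finset.Ici i, x.2 i') - 1 := fun x hx i =>
    hexp _ (Finset.sum_pos (fun i _ => (hDpos x hx).2 i) ⟨i, by simp⟩)
  have hCc : ∀ x ∈ D, ∀ j : Fin p, 0 < Real.exp (∑ j' ∈ Finset.Ici j.succ, x.1 j') - 1 :=
    fun x hx j => hexp _ (Finset.sum_pos (fun i _ => (hDpos x hx).1 i) ⟨j.succ, by simp⟩)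
  have hGr : ∀ j, 0 < Real.Gamma (kr j : ℝ) := fun j =>
    Real.Gamma_pos_of_pos (by exact_mod_cast hkr j)
  have hGc : ∀ j, 0 < Real.Gamma (kc j : ℝ) := fun j =>
    Real.Gamma_pos_of_pos (by exact_mod_cast hkc j)
  have hc : 0 < (∏ j, Real.Gamma (kr j : ℝ)) * ∏ i, Real.Gamma (kc i : ℝ) :=
    mul_pos (Finset.prod_pos fun j _ => hGr j) (Finset.prod_pos fun j _ => hGc j)
  rw [eq_inv_mul_iff_mul_eq₀ hc.ne']
  rw [integral_eq_lintegral_of_nonneg_ae]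
  rotate_left
  · refine (ae_restrict_iff' hDm).2 (Filter.Eventually.of_forall fun x hx => ?_)
    have h1 := hA x hx
    have h2 := hB x hx
    have h3 := hCc x hx
    have h4 := (hDpos x hx).1
    have h5 := (hDpos x hx).2
    simp only [Pi.zero_apply]
    refine mul_nonneg (mul_nonneg (Finset.prod_nonneg fun j _ => (pow_pos (h4 j) _).le)
      (Finset.prod_nonneg fun j _ => (pow_pos (h5 j) _).le))
      (mul_nonneg (mul_nonneg (inv_pos.2 h1).le
        (Finset.prod_nonneg fun j _ => (inv_pos.2 (h2 j)).le))
        (Finset.prod_nonneg fun j _ => (div_pos (Real.exp_pos _) (h3 j)).le))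
  · exact Measurable.aestronglyMeasurable (by fun_prop)
  have hF : ∀ M : {M : (Fin (p + 1) → ℕ) × (Fin (q + 1) → ℕ) //
        Monotone M.1 ∧ 1 ≤ M.1 0 ∧ StrictMono M.2 ∧ M.1 0 < M.2 0},
      ENNReal.ofReal (((∏ j, Real.Gamma (kr j : ℝ)) * ∏ i, Real.Gamma (kc i : ℝ)) *
        ((∏ j, (M.1.1 j : ℝ) ^ kr j) * ∏ i, (M.1.2 i : ℝ) ^ kc i)⁻¹) =
      ∫⁻ x in D, (∏ j, (ENNReal.ofReal (x.1 j ^ (kr j - 1)) * auxE (M.1.1 j) (x.1 j))) *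
        ∏ i, (ENNReal.ofReal (x.2 i ^ (kc i - 1)) * auxE (M.1.2 i) (x.2 i)) := by
    rintro ⟨⟨a, b⟩, h1, h2, h3, h4⟩
    have ha : ∀ j, 1 ≤ a j := fun j => h2.trans (h1 (Fin.zero_le j))
    have hb : ∀ j, 1 ≤ b j := fun j => (h2.trans h4.le).trans (h3.monotone (Fin.zero_le j))
    rw [hD, Measure.volume_eq_prod, ← Measure.prod_restrict, volume_pi, volume_pi,
      Measure.restrict_pi_pi, Measure.restrict_pi_pi]
    rw [lintegral_prod_mul
      (f := fun x : Fin (p + 1) → ℝ =>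
        ∏ j, (ENNReal.ofReal (x j ^ (kr j - 1)) * auxE (a j) (x j)))
      (g := fun x : Fin (q + 1) → ℝ =>
        ∏ j, (ENNReal.ofReal (x j ^ (kc j - 1)) * auxE (b j) (x j)))
      (Finset.measurable_fun_prod _ fun i _ =>
        (aux_meas (kr i) (a i)).comp (measurable_pi_apply i)).aemeasurable
      (Finset.measurable_fun_prod _ fun i _ =>
        (aux_meas (kc i) (b i)).comp (measurable_pi_apply i)).aemeasurable]
    rw [aux_lintegral_prod _ _ (fun j t => ENNReal.ofReal (t ^ (kr j - 1)) * auxE (a j) t)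
      (fun j => aux_meas _ _),
      aux_lintegral_prod _ _ (fun j t => ENNReal.ofReal (t ^ (kc j - 1)) * auxE (b j) t)
      (fun j => aux_meas _ _)]
    simp only [aux_gamma _ _ (hkr _) (ha _), aux_gamma _ _ (hkc _) (hb _)]
    have p1 : ∀ j, 0 ≤ Real.Gamma (kr j : ℝ) * ((a j : ℝ) ^ kr j)⁻¹ := fun j =>
      mul_nonneg (hGr j).le (by positivity)
    have p2 : ∀ j, 0 ≤ Real.Gamma (kc j : ℝ) * ((b j : ℝ) ^ kc j)⁻¹ := fun j =>
      mul_nonneg (hGc j).le (by positivity)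
    rw [← ENNReal.ofReal_prod_of_nonneg (fun j _ => p1 j),
      ← ENNReal.ofReal_prod_of_nonneg (fun j _ => p2 j),
      ← ENNReal.ofReal_mul (Finset.prod_nonneg fun j _ => p1 j)]
    congr 1
    simp only [Finset.prod_mul_distrib, Finset.prod_inv_distrib, mul_inv]
    ring
  rw [← tsum_mul_left]
  have hL : ∀ M : {M : (Fin (p + 1) → ℕ) × (Fin (q + 1) → ℕ) //
        Monotone M.1 ∧ 1 ≤ M.1 0 ∧ StrictMono M.2 ∧ M.1 0 < M.2 0},
      (((∏ j, Real.Gamma (kr j : ℝ)) * ∏ i, Real.Gamma (kc i : ℝ)) *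
        ((∏ j, (M.1.1 j : ℝ) ^ kr j) * ∏ i, (M.1.2 i : ℝ) ^ kc i)⁻¹) =
      (ENNReal.ofReal (((∏ j, Real.Gamma (kr j : ℝ)) * ∏ i, Real.Gamma (kc i : ℝ)) *
        ((∏ j, (M.1.1 j : ℝ) ^ kr j) * ∏ i, (M.1.2 i : ℝ) ^ kc i)⁻¹)).toReal := fun M =>
    (ENNReal.toReal_ofReal (mul_nonneg hc.le (by positivity))).symm
  rw [tsum_congr hL, ← ENNReal.tsum_toReal_eq (fun _ => ENNReal.ofReal_ne_top)]
  congr 1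
  rw [tsum_congr hF, ← lintegral_tsum]
  · refine setLIntegral_congr_fun hDm fun x hx => ?_
    have h1 := hA x hx
    have h2 := hB x hx
    have h3 := hCc x hx
    have h4 := (hDpos x hx).1
    have h5 := (hDpos x hx).2
    have hp := aux_point p q x.1 x.2 h4 h5
    have hR : ∀ M : {M : (Fin (p + 1) → ℕ) × (Fin (q + 1) → ℕ) //
        Monotone M.1 ∧ 1 ≤ M.1 0 ∧ StrictMono M.2 ∧ M.1 0 < M.2 0},
        (∏ j, (ENNReal.ofReal (x.1 j ^ (kr j - 1)) * auxE (M.1.1 j) (x.1 j))) *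
        ∏ i, (ENNReal.ofReal (x.2 i ^ (kc i - 1)) * auxE (M.1.2 i) (x.2 i)) =
        ((∏ j, ENNReal.ofReal (x.1 j ^ (kr j - 1))) * ∏ i, ENNReal.ofReal (x.2 i ^ (kc i - 1))) *
        ((∏ j, auxE (M.1.1 j) (x.1 j)) * ∏ i, auxE (M.1.2 i) (x.2 i)) := by
      intro M
      simp only [Finset.prod_mul_distrib]
      ring
    simp only [hR]
    rw [ENNReal.tsum_mul_left, hp]
    have q1 : ∀ j ∈ Finset.univ, 0 ≤ x.1 j ^ (kr j - 1) := fun j _ => (pow_pos (h4 j) _).le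
    have q2 : ∀ j ∈ Finset.univ, 0 ≤ x.2 j ^ (kc j - 1) := fun j _ => (pow_pos (h5 j) _).le
    have q3 : ∀ i ∈ Finset.univ, 0 ≤ (Real.exp (∑ i' ∈ Finset.Ici i, x.2 i') - 1)⁻¹ :=
      fun j _ => (inv_pos.2 (h2 j)).le
    have q4 : ∀ j ∈ (Finset.univ : Finset (Fin p)),
        0 ≤ Real.exp (∑ j' ∈ Finset.Ici j.succ, x.1 j') /
            (Real.exp (∑ j' ∈ Finset.Ici j.succ, x.1 j') - 1) :=
      fun j _ => (div_pos (Real.exp_pos _) (h3 j)).le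
    rw [← ENNReal.ofReal_prod_of_nonneg q1, ← ENNReal.ofReal_prod_of_nonneg q2,
      ← ENNReal.ofReal_prod_of_nonneg q3, ← ENNReal.ofReal_prod_of_nonneg q4,
      ← ENNReal.ofReal_mul (Finset.prod_nonneg q1),
      ← ENNReal.ofReal_mul (inv_pos.2 h1).le,
      ← ENNReal.ofReal_mul (mul_nonneg (inv_pos.2 h1).le (Finset.prod_nonneg q3)),
      ← ENNReal.ofReal_mul (mul_nonneg (Finset.prod_nonneg q1) (Finset.prod_nonneg q2))]
  · intro M
    refine Measurable.aemeasurable (Measurable.mul ?_ ?_)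
    · exact Finset.measurable_fun_prod _ fun i _ =>
        (aux_meas (kr i) (M.1.1 i)).comp ((measurable_pi_apply i).comp measurable_fst)
    · exact Finset.measurable_fun_prod _ fun i _ =>
        (aux_meas (kc i) (M.1.2 i)).comp ((measurable_pi_apply i).comp measurable_snd)
end

section
/- Let λ be a partition with c = |C(λ)| corners and let k = (k_{ij}) be a filling of D(λ) by positive integers with k_{ij} > 1 at every corner. Then for all real z_1, …, z_c > 0 one has 0 ≤ Li_k^λ(1−e^{−z_1}, …, 1−e^{−z_c}) ≤ ζ_λ(k), and consequently the multiple integral ∫_0^∞ ⋯ ∫_0^∞ z_1^{s_1−1} ⋯ z_c^{s_c−1} · Li_k^λ(1−e^{−z_1},…,1−e^{−z_c}) / ((e^{z_1}−1) ⋯ (e^{z_c}−1)) dz_1 ⋯ dz_c defining Γ(s_1)⋯Γ(s_c)·ξ^λ(k; s_1,…,s_c) converges absolutely for all s_1, …, s_c ∈ ℂ with Re(s_i) > 0 (i = 1, …, c). -/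
open MeasureTheory

/-- The Young diagram of the partition `λ = (lam 0, …, lam (r-1))`. -/
def YD (r : ℕ) (lam : ℕ → ℕ) : Set (ℕ × ℕ) := {p | p.1 < r ∧ p.2 < lam p.1}

/-- The set of corners of the Young diagram. -/
def Corners (r : ℕ) (lam : ℕ → ℕ) : Set (ℕ × ℕ) :=
  {p | p ∈ YD r lam ∧ (p.1 + 1, p.2) ∉ YD r lam ∧ (p.1, p.2 + 1) ∉ YD r lam}

/-- Semistandard Young tableaux of shape `λ`. -/
def Ssyt (r : ℕ) (lam : ℕ → ℕ) : Set ((ℕ × ℕ) → ℕ) :=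
  {m | (∀ p ∈ YD r lam, 1 ≤ m p) ∧ (∀ p, p ∉ YD r lam → m p = 0) ∧
    (∀ i j, (i, j + 1) ∈ YD r lam → m (i, j) ≤ m (i, j + 1)) ∧
    (∀ i j, (i + 1, j) ∈ YD r lam → m (i, j) < m (i + 1, j))}

/-- The (real-valued) Schur type polylogarithm `Li_k^λ(z)` for real corner variables. -/
noncomputable def SLiR (r : ℕ) (lam : ℕ → ℕ) (c : ℕ) (e : Fin c → ℕ × ℕ)
    (k : ℕ × ℕ → ℕ) (z : Fin c → ℝ) : ℝ :=
  ∑' m : Ssyt r lam,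
    (∏ i, z i ^ m.1 (e i)) / ∏ᶠ (p) (_ : p ∈ YD r lam), (m.1 p : ℝ) ^ k p


/-- A finite product of summable nonnegative families is summable on the function space. -/
theorem aux_summable_pi {ι : Type*} [Fintype ι] [DecidableEq ι] (f : ℕ → ℝ) (hf : ∀ n, 0 ≤ f n)
    (hs : Summable f) : Summable (fun m : ι → ℕ => ∏ i, f (m i)) := by
  classical
  refine summable_of_sum_le (c := ∏ _i : ι, ∑' n, f n)
    (fun m => Finset.prod_nonneg fun i _ => hf _) fun u => ?_
  calc ∑ m ∈ u, ∏ i, f (m i)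
      ≤ ∑ m ∈ Fintype.piFinset (fun i : ι => u.image (fun m => m i)), ∏ i, f (m i) := by
        refine Finset.sum_le_sum_of_subset_of_nonneg ?_
          (fun m _ _ => Finset.prod_nonneg fun i _ => hf _)
        intro m hm
        rw [Fintype.mem_piFinset]
        intro i
        exact Finset.mem_image_of_mem _ hm
    _ = ∏ i : ι, ∑ n ∈ u.image (fun m : ι → ℕ => m i), f n :=
        (Finset.prod_univ_sum _ (fun _ n => f n)).symm
    _ ≤ ∏ _i : ι, ∑' n, f n := by
        refine Finset.prod_le_prod (fun i _ => Finset.sum_nonneg fun n _ => hf n) fun i _ => ?_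
        exact hs.sum_le_tsum _ (fun n _ => hf n)

theorem aux_finite (r : ℕ) (lam : ℕ → ℕ) (hanti : ∀ i j, i ≤ j → j < r → lam j ≤ lam i) :
    (YD r lam).Finite := by
  refine ((Finset.range r ×ˢ Finset.range (lam 0)).finite_toSet).subset ?_
  rintro ⟨i, j⟩ ⟨h1, h2⟩
  have := hanti 0 i (Nat.zero_le _) h1
  simp only [Finset.coe_product, Set.mem_prod, Finset.mem_coe, Finset.mem_range]
  exact ⟨h1, lt_of_lt_of_le h2 this⟩

theorem aux_corner (r : ℕ) (lam : ℕ → ℕ) (hfin : (YD r lam).Finite) (hne : (YD r lam).Nonempty)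
    (m : ℕ × ℕ → ℕ) (hm : m ∈ Ssyt r lam) :
    ∃ q ∈ Corners r lam, ∀ p ∈ YD r lam, m p ≤ m q := by
  obtain ⟨a, ha, hmax⟩ := Set.exists_max_image _ m hfin hne
  have hfin2 : {p | p ∈ YD r lam ∧ m a ≤ m p}.Finite := hfin.subset fun p hp => hp.1
  obtain ⟨q, hq, hqmax⟩ := Set.exists_max_image _ (fun p : ℕ × ℕ => p.1 + p.2) hfin2
    ⟨a, ha, le_rfl⟩
  obtain ⟨-, -, hrow, hcol⟩ := hm
  refine ⟨q, ⟨hq.1, ?_, ?_⟩, fun p hp => (hmax p hp).trans hq.2⟩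
  · intro h
    have h1 := hqmax _ ⟨h, hq.2.trans (hcol q.1 q.2 h).le⟩
    simp only at h1
    omega
  · intro h
    have h1 := hqmax _ ⟨h, hq.2.trans (hrow q.1 q.2 h)⟩
    simp only at h1
    omega

theorem aux_summable (r : ℕ) (lam : ℕ → ℕ) (hfin : (YD r lam).Finite)
    (k : ℕ × ℕ → ℕ) (hk : ∀ p ∈ YD r lam, 1 ≤ k p)
    (hkc : ∀ p ∈ Corners r lam, 1 < k p) :
    Summable (fun m : Ssyt r lam => (∏ᶠ (p) (_ : p ∈ YD r lam), (m.1 p : ℝ) ^ k p)⁻¹) := by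
  classical
  set S : Finset (ℕ × ℕ) := hfin.toFinset with hS
  have hmem : ∀ p, p ∈ S ↔ p ∈ YD r lam := fun p => by simp [hS]
  set ε : ℝ := ((S.card : ℝ) + 1)⁻¹ with hε
  have hε0 : 0 < ε := by positivity
  have hsum : Summable (fun n : ℕ => ((n : ℝ) ^ (1 + ε))⁻¹) :=
    Real.summable_nat_rpow_inv.2 (by linarith)
  have h1 := aux_summable_pi (ι := S) _ (fun n => by positivity) hsum
  have hinj : Function.Injective (fun (m : Ssyt r lam) (p : S) => m.1 p.1) := by
    intro m m' h
    apply Subtype.ext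
    funext p
    by_cases hp : p ∈ YD r lam
    · exact congrFun h ⟨p, (hmem p).2 hp⟩
    · rw [m.2.2.1 p hp, m'.2.2.1 p hp]
  refine Summable.of_nonneg_of_le (fun m => ?_) (fun m => ?_) (h1.comp_injective hinj)
  · rw [finprod_mem_eq_finite_toFinset_prod _ hfin]
    exact inv_nonneg.2 (Finset.prod_nonneg fun p _ => by positivity)
  · rw [finprod_mem_eq_finite_toFinset_prod _ hfin]
    simp only [Function.comp]
    have e1 : ∏ p : S, ((m.1 p.1 : ℝ) ^ (1 + ε))⁻¹ = (∏ p ∈ S, (m.1 p : ℝ) ^ (1 + ε))⁻¹ := by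
      rw [← Finset.prod_inv_distrib, ← Finset.prod_coe_sort S]
    rw [e1]
    have hone : ∀ p ∈ S, (1 : ℝ) ≤ m.1 p := fun p hp => by
      exact_mod_cast m.2.1 p ((hmem p).1 hp)
    have hpp : ∀ p ∈ S, (0 : ℝ) < m.1 p := fun p hp => lt_of_lt_of_le one_pos (hone p hp)
    refine inv_anti₀ (Finset.prod_pos fun p hp => Real.rpow_pos_of_pos (hpp p hp) _) ?_
    rcases S.eq_empty_or_nonempty with hemp | hne
    · rw [← hS, hemp]; simp
    obtain ⟨q, hq, hqmax⟩ := aux_corner r lam hfin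
      (by obtain ⟨x, hx⟩ := hne; exact ⟨x, (hmem x).1 hx⟩) m.1 m.2
    have hqS : q ∈ S := (hmem q).2 hq.1
    calc ∏ p ∈ S, (m.1 p : ℝ) ^ (1 + ε)
        = (∏ p ∈ S, (m.1 p : ℝ)) * ∏ p ∈ S, (m.1 p : ℝ) ^ ε := by
          rw [← Finset.prod_mul_distrib]
          refine Finset.prod_congr rfl fun p hp => ?_
          rw [Real.rpow_add (hpp p hp), Real.rpow_one]
      _ ≤ (∏ p ∈ S, (m.1 p : ℝ)) * (m.1 q : ℝ) := by
          refine mul_le_mul_of_nonneg_left ?_ (Finset.prod_nonneg fun p hp => (hpp p hp).le)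
          calc ∏ p ∈ S, (m.1 p : ℝ) ^ ε ≤ ∏ p ∈ S, (m.1 q : ℝ) ^ ε := by
                refine Finset.prod_le_prod (fun p hp => by positivity) fun p hp => ?_
                refine Real.rpow_le_rpow (hpp p hp).le ?_ hε0.le
                exact_mod_cast hqmax p ((hmem p).1 hp)
            _ = (m.1 q : ℝ) ^ (ε * S.card) := by
                rw [Finset.prod_const, ← Real.rpow_natCast, ← Real.rpow_mul (hpp q hqS).le]
            _ ≤ (m.1 q : ℝ) ^ (1 : ℝ) := by
                refine Real.rpow_le_rpow_of_exponent_le (hone q hqS) ?_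
                rw [hε, inv_mul_le_iff₀ (by positivity)]
                linarith
            _ = m.1 q := Real.rpow_one _
      _ = ∏ p ∈ S, (m.1 p : ℝ) ^ (if p = q then 2 else 1) := by
          rw [← Finset.prod_erase_mul _ _ hqS, ← Finset.prod_erase_mul _ _ hqS]
          have : ∏ p ∈ S.erase q, (m.1 p : ℝ) ^ (if p = q then 2 else 1)
              = ∏ p ∈ S.erase q, (m.1 p : ℝ) := by
            refine Finset.prod_congr rfl fun p hp => ?_
            rw [if_neg (Finset.ne_of_mem_erase hp), pow_one]
          rw [this, if_pos rfl]
          ring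
      _ ≤ ∏ p ∈ S, (m.1 p : ℝ) ^ k p := by
          refine Finset.prod_le_prod (fun p hp => by positivity) fun p hp => ?_
          refine pow_le_pow_right₀ (hone p hp) ?_
          split_ifs with h
          · rw [h]; exact hkc q hq
          · exact hk p ((hmem p).1 hp)

/-- For `z₁, …, z_c > 0` one has
`0 ≤ Li_k^λ(1-e^{-z₁},…,1-e^{-z_c}) ≤ ζ_λ(k)`, and consequently the integral defining
`Γ(s₁)⋯Γ(s_c) ξ^λ(k; s₁,…,s_c)` converges absolutely whenever `Re(s_i) > 0`. -/
theorem stmt4 (r : ℕ) (lam : ℕ → ℕ)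
    (hpos : ∀ i, i < r → 0 < lam i)
    (hanti : ∀ i j, i ≤ j → j < r → lam j ≤ lam i)
    (c : ℕ) (e : Fin c → ℕ × ℕ)
    (he : Function.Injective e ∧ Set.range e = Corners r lam)
    (k : ℕ × ℕ → ℕ) (hk : ∀ p ∈ YD r lam, 1 ≤ k p)
    (hkc : ∀ p ∈ Corners r lam, 1 < k p) :
    (∀ z : Fin c → ℝ, (∀ i, 0 < z i) →
      0 ≤ SLiR r lam c e k (fun i => 1 - Real.exp (-z i)) ∧
      SLiR r lam c e k (fun i => 1 - Real.exp (-z i)) ≤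
        ∑' m : Ssyt r lam, (∏ᶠ (p) (_ : p ∈ YD r lam), (m.1 p : ℝ) ^ k p)⁻¹) ∧
    ∀ s : Fin c → ℂ, (∀ i, 0 < (s i).re) →
      IntegrableOn
        (fun z : Fin c → ℝ =>
          (∏ i, (z i : ℂ) ^ (s i - 1)) *
            ((SLiR r lam c e k (fun i => 1 - Real.exp (-z i)) /
              ∏ i, (Real.exp (z i) - 1) : ℝ) : ℂ))
        (Set.univ.pi fun _ => Set.Ioi (0 : ℝ)) := by
  have hfin := aux_finite r lam hanti
  have hsum := aux_summable r lam hfin k hk hkc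
  set W : Ssyt r lam → ℝ := fun m => (∏ᶠ (p) (_ : p ∈ YD r lam), (m.1 p : ℝ) ^ k p)⁻¹ with hW
  have hW0 : ∀ m, 0 ≤ W m := by
    intro m
    simp only [hW]
    rw [finprod_mem_eq_finite_toFinset_prod _ hfin]
    exact inv_nonneg.2 (Finset.prod_nonneg fun p _ => by positivity)
  have hSL : ∀ x : Fin c → ℝ, SLiR r lam c e k x = ∑' m : Ssyt r lam, (∏ i, x i ^ m.1 (e i)) * W m := by
    intro x
    simp only [SLiR, hW, div_eq_mul_inv]
  have hx0 : ∀ t : ℝ, 0 < t → 0 ≤ 1 - Real.exp (-t) := fun t ht => by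
    have : Real.exp (-t) ≤ 1 := Real.exp_le_one_iff.2 (by linarith)
    linarith
  have hx1 : ∀ t : ℝ, 1 - Real.exp (-t) ≤ 1 := fun t => by
    linarith [Real.exp_pos (-t)]
  have hm1 : ∀ (m : Ssyt r lam) (i : Fin c), 1 ≤ m.1 (e i) := fun m i => by
    have : e i ∈ Corners r lam := he.2 ▸ Set.mem_range_self i
    exact m.2.1 _ this.1
  have hT0 : ∀ z : Fin c → ℝ, (∀ i, 0 < z i) → ∀ m : Ssyt r lam,
      0 ≤ (∏ i, (1 - Real.exp (-z i)) ^ m.1 (e i)) * W m := fun z hz m =>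
    mul_nonneg (Finset.prod_nonneg fun i _ => pow_nonneg (hx0 _ (hz i)) _) (hW0 m)
  have hT1 : ∀ z : Fin c → ℝ, (∀ i, 0 < z i) → ∀ m : Ssyt r lam,
      (∏ i, (1 - Real.exp (-z i)) ^ m.1 (e i)) * W m ≤ (∏ i, (1 - Real.exp (-z i))) * W m :=
    fun z hz m => by
      refine mul_le_mul_of_nonneg_right ?_ (hW0 m)
      refine Finset.prod_le_prod (fun i _ => pow_nonneg (hx0 _ (hz i)) _) fun i _ => ?_
      exact pow_le_of_le_one (hx0 _ (hz i)) (hx1 _) (by have := hm1 m i; omega)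
  have hP1 : ∀ z : Fin c → ℝ, (∀ i, 0 < z i) → (∏ i, (1 - Real.exp (-z i))) ≤ 1 := fun z hz =>
    Finset.prod_le_one (fun i _ => hx0 _ (hz i)) fun i _ => hx1 _
  have hT2 : ∀ z : Fin c → ℝ, (∀ i, 0 < z i) → ∀ m : Ssyt r lam,
      (∏ i, (1 - Real.exp (-z i)) ^ m.1 (e i)) * W m ≤ W m := fun z hz m =>
    (hT1 z hz m).trans (mul_le_of_le_one_left (hW0 m) (hP1 z hz))
  have hS0 : ∀ z : Fin c → ℝ, (∀ i, 0 < z i) →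
      0 ≤ SLiR r lam c e k (fun i => 1 - Real.exp (-z i)) := fun z hz => by
    rw [hSL]
    exact tsum_nonneg (hT0 z hz)
  have hS1 : ∀ z : Fin c → ℝ, (∀ i, 0 < z i) →
      SLiR r lam c e k (fun i => 1 - Real.exp (-z i)) ≤
        (∏ i, (1 - Real.exp (-z i))) * ∑' m, W m := fun z hz => by
    rw [hSL, ← tsum_mul_left]
    exact Summable.tsum_le_tsum (hT1 z hz)
      (Summable.of_nonneg_of_le (hT0 z hz) (hT2 z hz) hsum) (hsum.mul_left _)
  refine ⟨fun z hz => ⟨hS0 z hz, (hS1 z hz).trans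
    (mul_le_of_le_one_left (tsum_nonneg hW0) (hP1 z hz))⟩, fun s hs => ?_⟩
  have hD : ∀ z ∈ (Set.univ.pi fun _ => Set.Ioi (0 : ℝ) : Set (Fin c → ℝ)), ∀ i, 0 < z i :=
    fun z hz i => hz i (Set.mem_univ i)
  have hDm : MeasurableSet (Set.univ.pi fun _ => Set.Ioi (0 : ℝ) : Set (Fin c → ℝ)) :=
    MeasurableSet.univ_pi fun _ => measurableSet_Ioi
  have hcontS : ContinuousOn (fun z : Fin c → ℝ =>
      SLiR r lam c e k (fun i => 1 - Real.exp (-z i))) (Set.univ.pi fun _ => Set.Ioi (0 : ℝ)) := by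
    simp only [hSL]
    refine continuousOn_tsum (u := W) (fun m => ?_) hsum (fun m z hz => ?_)
    · exact Continuous.continuousOn (by fun_prop)
    · rw [Real.norm_of_nonneg (hT0 z (hD z hz) m)]
      exact hT2 z (hD z hz) m
  have hcont : ContinuousOn (fun z : Fin c → ℝ =>
          (∏ i, (z i : ℂ) ^ (s i - 1)) *
            ((SLiR r lam c e k (fun i => 1 - Real.exp (-z i)) /
              ∏ i, (Real.exp (z i) - 1) : ℝ) : ℂ))
        (Set.univ.pi fun _ => Set.Ioi (0 : ℝ)) := by
    refine ContinuousOn.mul ?_ ?_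
    · refine continuousOn_finsetProd _ fun i _ => ?_
      refine ContinuousOn.cpow_const ?_ fun z hz => ?_
      · exact Continuous.continuousOn (by fun_prop)
      · exact Complex.ofReal_mem_slitPlane.2 (hD z hz i)
    · refine Complex.continuous_ofReal.comp_continuousOn (hcontS.div ?_ fun z hz => ?_)
      · exact Continuous.continuousOn (by fun_prop)
      · refine Finset.prod_ne_zero_iff.2 fun i _ => ?_
        have := Real.one_lt_exp_iff.2 (hD z hz i)
        exact sub_ne_zero.2 this.ne'
  have hint : IntegrableOn (fun z : Fin c → ℝ =>
      (∏ i, (Real.exp (-z i) * z i ^ ((s i).re - 1))) * ∑' m, W m)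
      (Set.univ.pi fun _ => Set.Ioi (0 : ℝ)) := by
    refine Integrable.mul_const ?_ _
    rw [volume_pi, Measure.restrict_pi_pi]
    exact Integrable.fintype_prod fun i => Real.GammaIntegral_convergent (hs i)
  refine Integrable.mono' hint (hcont.aestronglyMeasurable hDm) ?_
  refine (ae_restrict_iff' hDm).2 (Filter.Eventually.of_forall fun z hz => ?_)
  have hz' := hD z hz
  have hE : ∀ i, 0 < Real.exp (z i) - 1 := fun i => sub_pos.2 (Real.one_lt_exp_iff.2 (hz' i))
  have hEP : 0 < ∏ i, (Real.exp (z i) - 1) := Finset.prod_pos fun i _ => hE i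
  rw [norm_mul, norm_prod, Complex.norm_real,
    Real.norm_of_nonneg (div_nonneg (hS0 z hz') hEP.le)]
  have e1 : ∀ i, ‖(z i : ℂ) ^ (s i - 1)‖ = z i ^ ((s i).re - 1) := fun i => by
    rw [Complex.norm_cpow_eq_rpow_re_of_pos (hz' i)]; simp
  simp only [e1]
  rw [Finset.prod_mul_distrib, mul_comm (∏ i, Real.exp (-z i)), mul_assoc]
  refine mul_le_mul_of_nonneg_left ?_
    (Finset.prod_nonneg fun i _ => Real.rpow_nonneg (hz' i).le _)
  rw [div_le_iff₀ hEP]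
  refine (hS1 z hz').trans (le_of_eq ?_)
  rw [mul_right_comm, ← Finset.prod_mul_distrib]
  congr 1
  refine Finset.prod_congr rfl fun i _ => ?_
  rw [mul_sub, ← Real.exp_add]
  simp
end
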